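/- The Generalised Synchronisability Problem for mailbox systems is undecidable: there is no algorithm that, given a network of communicating automata with final states, decides whether τ(S_mb(N)) = τ(S_sync(N)). -/

import Mathlib

/-- A message with sender, receiver and payload. -/
structure Msg (P A : Type) where
  sender : P
  receiver : P
  payload : A
deriving DecidableEq

/-- Actions: send `!m` or receive `?m`. -/
inductive Act (P A : Type) where
  | send : Msg P A → Act P A
  | recv : Msg P A → Act P A
deriving DecidableEq

namespace Act
variable {P A : Type}
def msg : Act P A → Msg P A | send m => m | recv m => m
def isSend : Act P A → Bool | send _ => true | recv _ => false
/-- The active participant of an action. -/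
def active : Act P A → P | send m => m.sender | recv m => m.receiver
end Act

section Defs
variable {P A : Type}

/-- Projection onto send actions `w↓_!`. -/
def projOut (w : List (Act P A)) : List (Act P A) := w.filter Act.isSend
/-- Projection onto receive actions `w↓_?`. -/
def projIn (w : List (Act P A)) : List (Act P A) := w.filter (fun a => !a.isSend)
/-- Erase the `!`/`?` marks: `w↓_msg`. -/
def projMsg (w : List (Act P A)) : List (Msg P A) := w.map Act.msg
/-- Projection onto actions in which `p` is active: `w↓_p`. -/
def projPeer [DecidableEq P] (p : P) (w : List (Act P A)) : List (Act P A) :=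
  w.filter (fun a => decide (a.active = p))
/-- Projection onto actions involving only participants in `{p, q}`. -/
def projPQ [DecidableEq P] (p q : P) (w : List (Act P A)) : List (Act P A) :=
  w.filter (fun a =>
    (decide (a.msg.sender = p) || decide (a.msg.sender = q)) &&
    (decide (a.msg.receiver = p) || decide (a.msg.receiver = q)))

/-- A network of communicating automata. -/
structure Network (P A : Type) where
  State : P → Type
  init : ∀ p, State p
  trans : ∀ p, State p → Act P A → State p → Prop
  final : ∀ p, Set (State p)
  Msgs : Set (Msg P A)

/-- Well-formedness: each automaton only performs actions in which it is active,
on messages of the network. -/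
def Network.WF (N : Network P A) : Prop :=
  ∀ p s a s', N.trans p s a s' → a.msg ∈ N.Msgs ∧ a.active = p

/-- The set of participants sending to `p`. -/
def senders (N : Network P A) (p : P) : Set P :=
  {q | ∃ m ∈ N.Msgs, m.sender = q ∧ m.receiver = p}

/-- Directed edge of the topology. -/
def Network.Edge (N : Network P A) (p q : P) : Prop :=
  ∃ m ∈ N.Msgs, m.sender = p ∧ m.receiver = q

/-- The underlying undirected topology graph. -/
def topoGraph (N : Network P A) : SimpleGraph P := SimpleGraph.fromRel N.Edge

/-- Tree topology: connected, acyclic, and every participant has at most one sender. -/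
def TreeTopo (N : Network P A) : Prop :=
  (topoGraph N).IsTree ∧ ∀ p, (senders N p).Subsingleton

/-- Generic multi-step relation labelled by words of actions. -/
inductive Steps {C : Type _} (step : C → Act P A → C → Prop) : C → List (Act P A) → C → Prop where
  | nil (c : C) : Steps step c [] c
  | cons {c c' c'' : C} {a : Act P A} {w : List (Act P A)} :
      step c a c' → Steps step c' w c'' → Steps step c (a :: w) c''

variable [DecidableEq P]

/-! ### Mailbox semantics -/

structure MbConfig (N : Network P A) where
  st : ∀ p, N.State p
  buf : P → List (Msg P A)

inductive MbStep (N : Network P A) : MbConfig N → Act P A → MbConfig N → Prop where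
  | send (c : MbConfig N) (m : Msg P A) (s' : N.State m.sender) :
      N.trans m.sender (c.st m.sender) (.send m) s' →
      MbStep N c (.send m)
        ⟨Function.update c.st m.sender s',
         Function.update c.buf m.receiver (c.buf m.receiver ++ [m])⟩
  | recv (c : MbConfig N) (m : Msg P A) (s' : N.State m.receiver) (rest : List (Msg P A)) :
      N.trans m.receiver (c.st m.receiver) (.recv m) s' →
      c.buf m.receiver = m :: rest →
      MbStep N c (.recv m)
        ⟨Function.update c.st m.receiver s',
         Function.update c.buf m.receiver rest⟩

def MbInit (N : Network P A) : MbConfig N := ⟨N.init, fun _ => []⟩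
def MbFinal (N : Network P A) (c : MbConfig N) : Prop := ∀ p, c.st p ∈ N.final p
def MbReachable (N : Network P A) (c : MbConfig N) : Prop :=
  ∃ w, Steps (MbStep N) (MbInit N) w c
def MbExecs (N : Network P A) : Set (List (Act P A)) :=
  {w | ∃ c, Steps (MbStep N) (MbInit N) w c ∧ MbFinal N c}
def MbTraces (N : Network P A) : Set (List (Act P A)) := projOut '' MbExecs N

/-! ### Peer-to-peer semantics -/

structure P2pConfig (N : Network P A) where
  st : ∀ p, N.State p
  buf : P → P → List (Msg P A)

inductive P2pStep (N : Network P A) : P2pConfig N → Act P A → P2pConfig N → Prop where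
  | send (c : P2pConfig N) (m : Msg P A) (s' : N.State m.sender) :
      N.trans m.sender (c.st m.sender) (.send m) s' →
      P2pStep N c (.send m)
        ⟨Function.update c.st m.sender s',
         Function.update c.buf m.sender
           (Function.update (c.buf m.sender) m.receiver (c.buf m.sender m.receiver ++ [m]))⟩
  | recv (c : P2pConfig N) (m : Msg P A) (s' : N.State m.receiver) (rest : List (Msg P A)) :
      N.trans m.receiver (c.st m.receiver) (.recv m) s' →
      c.buf m.sender m.receiver = m :: rest →
      P2pStep N c (.recv m)
        ⟨Function.update c.st m.receiver s',
         Function.update c.buf m.sender (Function.update (c.buf m.sender) m.receiver rest)⟩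

def P2pInit (N : Network P A) : P2pConfig N := ⟨N.init, fun _ _ => []⟩
def P2pExecs (N : Network P A) : Set (List (Act P A)) :=
  {w | ∃ c, Steps (P2pStep N) (P2pInit N) w c ∧ ∀ p, c.st p ∈ N.final p}
def P2pTraces (N : Network P A) : Set (List (Act P A)) := projOut '' P2pExecs N

/-! ### Synchronous semantics -/

inductive SyncStep (N : Network P A) : (∀ p, N.State p) → Act P A → (∀ p, N.State p) → Prop where
  | comm (st : ∀ p, N.State p) (m : Msg P A) (s1 : N.State m.sender) (s2 : N.State m.receiver) :
      N.trans m.sender (st m.sender) (.send m) s1 →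
      N.trans m.receiver (st m.receiver) (.recv m) s2 →
      SyncStep N st (.send m)
        (Function.update (Function.update st m.sender s1) m.receiver s2)

def SyncExecs (N : Network P A) : Set (List (Act P A)) :=
  {w | ∃ st, Steps (SyncStep N) N.init w st ∧ ∀ p, st p ∈ N.final p}
def SyncTraces (N : Network P A) : Set (List (Act P A)) := projOut '' SyncExecs N

/-! ### Local and influenced languages -/

inductive LocalPath (N : Network P A) (p : P) : N.State p → List (Act P A) → N.State p → Prop where
  | nil (s : N.State p) : LocalPath N p s [] s
  | cons {s s' s'' : N.State p} {a : Act P A} {w : List (Act P A)} :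
      N.trans p s a s' → LocalPath N p s' w s'' → LocalPath N p s (a :: w) s''

/-- The language `L(A_p)` of the automaton of participant `p`. -/
def LocalLang (N : Network P A) (p : P) : Set (List (Act P A)) :=
  {w | ∃ s, LocalPath N p (N.init p) w s ∧ s ∈ N.final p}

/-- `L` is the family of influenced languages `L_T(A_p)` of a tree-topology network. -/
def IsInfluenced (N : Network P A) (L : P → Set (List (Act P A))) : Prop :=
  (∀ p, senders N p = ∅ → L p = LocalLang N p) ∧
  (∀ p q, senders N p = {q} →
    L p = {w ∈ LocalLang N p | ∃ v ∈ L q, projMsg (projIn w) = projMsg (projOut v)})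

/-! ### Shuffles -/

/-- One swap replacing an adjacent `!x ?y` by `?y !x`. -/
inductive SwapStep : List (Act P A) → List (Act P A) → Prop where
  | swap (u v : List (Act P A)) (x y : Msg P A) :
      SwapStep (u ++ Act.send x :: Act.recv y :: v) (u ++ Act.recv y :: Act.send x :: v)

/-- `w' ⋈_? w`: `w'` is a valid input shuffle of `w`. -/
def ValidShuffle (w' w : List (Act P A)) : Prop := Relation.ReflTransGen SwapStep w w'

/-- The shuffled language `L_⋈(p)` of a language. -/
def ShuffleLang (Lp : Set (List (Act P A))) : Set (List (Act P A)) :=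
  {w' | ∃ w ∈ Lp, ValidShuffle w' w}

/-- Insert after each send action its matching receive action. -/
def withRecvs (w : List (Act P A)) : List (Act P A) :=
  w.flatMap fun a => match a with
    | .send m => [.send m, .recv m]
    | .recv m => [.recv m]

end Defs

/-- A finite code for a network: number of participants, transition table
(participant, state, (isSend, sender, receiver, payload), next state),
final-state table, and message table. -/
abbrev NetCode : Type :=
  ℕ × List (ℕ × ℕ × (Bool × ℕ × ℕ × ℕ) × ℕ) × List (ℕ × ℕ) × List (ℕ × ℕ × ℕ)

/-- Semantics of a network code. -/
def decodeNet (c : NetCode) : Network (Fin c.1) ℕ where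
  State := fun _ => ℕ
  init := fun _ => 0
  trans := fun p s a s' =>
    (p.val, s, (a.isSend, a.msg.sender.val, a.msg.receiver.val, a.msg.payload), s') ∈ c.2.1
  final := fun p => {s | (p.val, s) ∈ c.2.2.1}
  Msgs := {m | (m.sender.val, m.receiver.val, m.payload) ∈ c.2.2.2}


/-- Binary increment on little-endian bit lists. -/
def incBits (l : List Bool) : List Bool :=
  List.rec [true] (fun b t ih => cond b (false :: ih) (true :: t)) l

def natBits (n : ℕ) : List Bool := Nat.rec [] (fun _ ih => incBits ih) n

theorem incBits_primrec : Primrec incBits := by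
  refine Primrec.list_rec (f := fun l : List Bool => l) (g := fun _ => [true])
    (h := fun _ p => cond p.1 (false :: p.2.2) (true :: p.2.1)) Primrec.id (Primrec.const _) ?_
  have h1 : Primrec (fun p : List Bool × (Bool × List Bool × List Bool) => p.2.1) :=
    Primrec.fst.comp Primrec.snd
  have h2 : Primrec (fun p : List Bool × (Bool × List Bool × List Bool) => p.2.2.1) :=
    Primrec.fst.comp (Primrec.snd.comp Primrec.snd)
  have h3 : Primrec (fun p : List Bool × (Bool × List Bool × List Bool) => p.2.2.2) :=
    Primrec.snd.comp (Primrec.snd.comp Primrec.snd)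
  exact Primrec.cond h1 (Primrec.list_cons.comp (Primrec.const _) h3)
    (Primrec.list_cons.comp (Primrec.const _) h2)

theorem natBits_primrec : Primrec natBits := by
  refine (Primrec.nat_rec₁ (f := fun _ ih => incBits ih) [] ?_)
  exact incBits_primrec.comp Primrec.snd

open Turing PartrecToTM2 in
theorem trPosNum_succ (p : PosNum) (l : List Bool)
    (h : trPosNum p = l.map (fun b => cond b Γ'.bit1 Γ'.bit0)) :
    trPosNum p.succ = (incBits l).map (fun b => cond b Γ'.bit1 Γ'.bit0) := by
  induction p generalizing l with
  | one =>
    rcases l with _ | ⟨b, _ | ⟨c, l⟩⟩ <;> try cases b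
    all_goals simp_all [trPosNum, PosNum.succ, incBits]
  | bit0 p ih =>
    rcases l with _ | ⟨b, l⟩ <;> try cases b
    all_goals simp_all [trPosNum, PosNum.succ, incBits]
  | bit1 p ih =>
    rcases l with _ | ⟨b, l⟩ <;> try cases b
    all_goals simp_all [trPosNum, PosNum.succ]
    have := ih l rfl
    simp_all [incBits]

open Turing PartrecToTM2 in
theorem trNat_eq (n : ℕ) : trNat n = (natBits n).map (fun b => cond b Γ'.bit1 Γ'.bit0) := by
  induction n with
  | zero => simp [natBits]
  | succ n ih =>
    have e : ((n + 1 : ℕ) : Num) = Num.succ (n : Num) := by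
      rw [Nat.cast_succ, Num.add_one]
    have e2 : natBits (n + 1) = incBits (natBits n) := rfl
    rw [trNat, e, e2]
    rw [trNat] at ih
    generalize (n : Num) = m at ih
    generalize natBits n = l at ih
    cases m with
    | zero =>
      cases l with
      | nil => rfl
      | cons b l => simp [trNum] at ih
    | pos p => exact trPosNum_succ p l ih

open Turing in
/-- Restrict a TM0 machine to a finite support. -/
noncomputable def restrictTM0 {Γ Λ : Type} [Inhabited Γ] [Inhabited Λ] (M : TM0.Machine Γ Λ)
    (S : Set Λ) (hS : TM0.Supports M S) (_i : Inhabited S) : TM0.Machine Γ S := fun q a =>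
  (M q.1 a).pmap (fun r hr => (⟨r.1, hr⟩, r.2))
    (fun r hr => by
      obtain ⟨q', s⟩ := r
      exact hS.2 hr q.2)

open Turing StateTransition in
theorem restrictTM0_dom {Γ Λ : Type} [Inhabited Γ] [Inhabited Λ] (M : TM0.Machine Γ Λ)
    (S : Set Λ) (hS : TM0.Supports M S) (i : Inhabited S) (hi : i.default.1 = default)
    (l : List Γ) :
    (TM0.eval (restrictTM0 M S hS i) l).Dom ↔ (TM0.eval M l).Dom := by
  have key := tr_eval_dom (f₁ := TM0.step (restrictTM0 M S hS i)) (f₂ := TM0.step M)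
    (tr := fun a b => (⟨a.q.1, a.Tape⟩ : TM0.Cfg Γ Λ) = b)
    (fun_respects (tr := fun a : TM0.Cfg Γ S => (⟨a.q.1, a.Tape⟩ : TM0.Cfg Γ Λ)) |>.2 (by
      intro a
      rcases a with ⟨q, T⟩
      rcases h : M q.1 T.head with _ | ⟨q', s⟩
      · have : restrictTM0 M S hS i q T.head = none := by simp [restrictTM0, h]
        simp [TM0.step, this, FRespects, h]
      · have : restrictTM0 M S hS i q T.head = some (⟨q', hS.2 h q.2⟩, s) := by
          simp [restrictTM0, h]
        simp only [TM0.step, this, FRespects, Option.map_some]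
        refine Relation.TransGen.single ?_
        simp only [TM0.step, h, Option.map_some]; rfl))
    (a₁ := TM0.init l) (a₂ := TM0.init l) (by simp [TM0.init]; exact hi)
  exact key.symm

open Turing in
theorem exists_source :
    ∃ (Γ Λ : Type) (_ : Inhabited Γ) (_ : Inhabited Λ) (_ : Fintype Γ) (_ : Fintype Λ)
      (M : TM0.Machine Γ Λ) (x y z : Γ), ∀ n,
      (TM0.eval M (x :: (natBits n).reverse.map (fun b => cond b y z))).Dom ↔
        (Nat.Partrec.Code.eval (Denumerable.ofNat Nat.Partrec.Code n) 0).Dom := by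
  have hf : Partrec (fun n : ℕ => Nat.Partrec.Code.eval (Denumerable.ofNat Nat.Partrec.Code n) 0) :=
    Nat.Partrec.Code.eval_part.comp (Computable.ofNat _) (Computable.const 0)
  obtain ⟨c, hc⟩ := ToPartrec.Code.exists_code (Nat.Partrec'.part_iff₁.2 hf)
  let : Fintype PartrecToTM2.K' := ⟨{.main, .rev, .aux, .stack}, by intro x; cases x <;> simp⟩
  let il : Inhabited PartrecToTM2.Λ' := ⟨PartrecToTM2.trNormal c .halt⟩
  have s2 := PartrecToTM2.tr_supports c .halt
  have s1 := TM2to1.tr_supports _ s2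
  have s0 := TM1to0.tr_supports _ s1
  let g : PartrecToTM2.Γ' → TM2to1.Γ' PartrecToTM2.K' (fun _ => PartrecToTM2.Γ') := fun a =>
    (false, Function.update (fun _ => none) .main (some a))
  let x : TM2to1.Γ' PartrecToTM2.K' (fun _ => PartrecToTM2.Γ') := (true, (g .cons).2)
  refine ⟨TM2to1.Γ' PartrecToTM2.K' (fun _ => PartrecToTM2.Γ'), _, inferInstance, ⟨⟨default, s0.1⟩⟩,
    inferInstance, Fintype.ofFinset _ (fun _ => Iff.rfl), restrictTM0 _ _ s0 ⟨⟨default, s0.1⟩⟩,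
    x, g .bit1, g .bit0, fun n => ?_⟩
  refine (restrictTM0_dom _ _ s0 ⟨⟨default, s0.1⟩⟩ rfl _).trans ?_
  have e : x :: (natBits n).reverse.map (fun b => cond b (g .bit1) (g .bit0)) =
      TM2to1.trInit PartrecToTM2.K'.main (PartrecToTM2.trList [n]) := by
    have r : (PartrecToTM2.trList [n]).reverse = .cons :: (natBits n).reverse.map
        (fun b => cond b PartrecToTM2.Γ'.bit1 PartrecToTM2.Γ'.bit0) := by
      simp [PartrecToTM2.trList, trNat_eq]
    rw [TM2to1.trInit, r]
    change x :: _ = x :: List.map g (List.map _ _)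
    congr 1
    rw [List.map_map]
    refine List.map_congr_left ?_
    intro b _; cases b <;> rfl
  rw [TM1to0.tr_eval, e]
  refine (TM2to1.tr_eval_dom _ _ _).trans ?_
  have h1 : (TM2.eval PartrecToTM2.tr PartrecToTM2.K'.main (PartrecToTM2.trList [n])).Dom ↔
      (StateTransition.eval (TM2.step PartrecToTM2.tr) (PartrecToTM2.init c [n])).Dom := by
    have : (TM2.init PartrecToTM2.K'.main (PartrecToTM2.trList [n]) :
        TM2.Cfg (fun _ : PartrecToTM2.K' => PartrecToTM2.Γ') PartrecToTM2.Λ'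
          (Option PartrecToTM2.Γ')) = PartrecToTM2.init c [n] := by
      simp only [TM2.init, PartrecToTM2.init]
      congr 1
      funext k
      cases k <;> simp [PartrecToTM2.K'.elim]
    simp only [TM2.eval, this]
    rfl
  rw [h1, PartrecToTM2.tr_eval]
  have h2 := hc ⟨[n], rfl⟩
  simp only at h2
  rw [h2]
  rfl

/-- Acceptance in a Post normal system: `u ++ w → w ++ v`, accept when the head is `h`. -/
inductive PAcc {α : Type} (R : Set (List α × List α)) (h : α) : List α → Prop
  | halt (w : List α) : PAcc R h (h :: w)
  | rule (u v w : List α) : (u, v) ∈ R → PAcc R h (w ++ v) → PAcc R h (u ++ w)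

/-- Symbols of the cyclic words encoding Turing machine configurations. -/
inductive TSym (Γ Λ : Type)
  | tape (a : Γ)
  | st (q : Λ)
  | hash
  | halt

instance {Γ Λ : Type} [Finite Γ] [Finite Λ] : Finite (TSym Γ Λ) := by
  refine Finite.of_injective (β := Γ ⊕ Λ ⊕ Bool) (fun s => match s with
    | .tape a => .inl a | .st q => .inr (.inl q)
    | .hash => .inr (.inr true) | .halt => .inr (.inr false)) ?_
  intro a b
  cases a <;> cases b <;> simp

section PNS
open Turing
set_option linter.unusedSectionVars false
set_option linter.unusedSimpArgs false
variable {Γ Λ : Type} [Inhabited Γ] [Inhabited Λ]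
open TSym

inductive PRule (M : TM0.Machine Γ Λ) : List (TSym Γ Λ) → List (TSym Γ Λ) → Prop
  | copy (s : TSym Γ Λ) : PRule M [s] [s]
  | ext (q : Λ) : PRule M [st q, hash] [st q, tape default, hash]
  | fini (q : Λ) (a : Γ) : M q a = none → PRule M [st q, tape a] [halt]
  | write (q : Λ) (a : Γ) (q' : Λ) (b : Γ) : M q a = some (q', .write b) →
      PRule M [st q, tape a] [st q', tape b]
  | right (q : Λ) (a : Γ) (q' : Λ) : M q a = some (q', .move .right) →
      PRule M [st q, tape a] [tape a, st q']
  | left (q : Λ) (a : Γ) (q' : Λ) (c : Γ) : M q a = some (q', .move .left) →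
      PRule M [tape c, st q, tape a] [st q', tape c, tape a]
  | left' (q : Λ) (a : Γ) (q' : Λ) : M q a = some (q', .move .left) →
      PRule M [hash, st q, tape a] [hash, st q', tape default, tape a]

def PRules (M : TM0.Machine Γ Λ) : Set (List (TSym Γ Λ) × List (TSym Γ Λ)) := {r | PRule M r.1 r.2}

theorem PRules_finite [Finite Γ] [Finite Λ] (M : TM0.Machine Γ Λ) : (PRules M).Finite := by
  refine Set.Finite.subset ((List.finite_length_le (TSym Γ Λ) 3).prod
    (List.finite_length_le (TSym Γ Λ) 4)) ?_
  rintro ⟨u, v⟩ h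
  cases h <;> simp

theorem PRules_ne_nil {M : TM0.Machine Γ Λ} {u v} (h : (u, v) ∈ PRules M) : u ≠ [] := by
  rintro rfl; cases h

def encW (q : Λ) (L R : List Γ) : List (TSym Γ Λ) :=
  st q :: (R.map tape ++ hash :: (L.map tape).reverse)

def cfgOf (q : Λ) (L R : List Γ) : TM0.Cfg Γ Λ := ⟨q, Tape.mk' (ListBlank.mk L) (ListBlank.mk R)⟩

def Halts (M : TM0.Machine Γ Λ) (c : TM0.Cfg Γ Λ) : Prop :=
  (StateTransition.eval (TM0.step M) c).Dom

theorem halts_none {M : TM0.Machine Γ Λ} {c} (h : TM0.step M c = none) : Halts M c :=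
  Part.dom_iff_mem.2 ⟨c, StateTransition.mem_eval.2 ⟨.refl, h⟩⟩

theorem halts_step {M : TM0.Machine Γ Λ} {c c'} (h : TM0.step M c = some c') :
    Halts M c ↔ Halts M c' := by
  unfold Halts
  rw [StateTransition.reaches_eval (Relation.ReflTransGen.single h)]

theorem rot_unique {α : Type} (P : α → Prop) {q q' : α} {x y : List α} (h : (q :: x) ~r (q' :: y))
    (hq : P q) (hy : ∀ s ∈ y, ¬ P s) : q = q' ∧ x = y := by
  obtain ⟨n, hn, e⟩ := List.isRotated_iff_mod.1 h
  rw [List.rotate_eq_drop_append_take hn] at e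
  rcases n with _ | n
  · simpa using e
  · simp only [List.drop_succ_cons, List.take_succ_cons] at e
    rcases hd : x.drop n with _ | ⟨b, B⟩
    · rw [hd] at e
      have : x.take n = x := by
        have := List.take_append_drop n x
        rwa [hd, List.append_nil] at this
      rw [this] at e
      simpa using e
    · rw [hd] at e
      simp only [List.cons_append, List.cons.injEq] at e
      exact absurd hq (hy q (by rw [← e.2]; simp))

def TSym.isSt : TSym Γ Λ → Prop | st _ => True | _ => False

theorem rot_enc {q q' : Λ} {x : List (TSym Γ Λ)} {L R : List Γ} (h : (st q :: x) ~r encW q' L R) :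
    q = q' ∧ x = R.map tape ++ hash :: (L.map tape).reverse := by
  have := rot_unique TSym.isSt h (by simp [TSym.isSt]) (by
    intro s hs
    simp at hs
    rcases hs with ⟨a, _, rfl⟩ | rfl | ⟨a, _, rfl⟩ <;> simp [TSym.isSt])
  simpa using this

theorem cfgOf_blank (q : Λ) (L : List Γ) : cfgOf q L [default] = cfgOf q L [] := by
  have : ListBlank.mk [default] = ListBlank.mk ([] : List Γ) := by
    apply Quotient.sound'
    right
    exact ⟨1, by simp⟩
  simp [cfgOf, this]

theorem step_stop {M : TM0.Machine Γ Λ} {q a} (h : M q a = none) (L R) :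
    TM0.step M (cfgOf q L (a :: R)) = none := by
  simp [TM0.step, cfgOf, h]

theorem step_write {M : TM0.Machine Γ Λ} {q a q' b} (h : M q a = some (q', .write b)) (L R) :
    TM0.step M (cfgOf q L (a :: R)) = some (cfgOf q' L (b :: R)) := by
  simp [TM0.step, cfgOf, h]

theorem step_right {M : TM0.Machine Γ Λ} {q a q'} (h : M q a = some (q', .move .right)) (L R) :
    TM0.step M (cfgOf q L (a :: R)) = some (cfgOf q' (a :: L) R) := by
  simp [TM0.step, cfgOf, h]

theorem step_left {M : TM0.Machine Γ Λ} {q a q'} (h : M q a = some (q', .move .left)) (c L R) :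
    TM0.step M (cfgOf q (c :: L) (a :: R)) = some (cfgOf q' L (c :: a :: R)) := by
  simp [TM0.step, cfgOf, h]

theorem step_left' {M : TM0.Machine Γ Λ} {q a q'} (h : M q a = some (q', .move .left)) (R) :
    TM0.step M (cfgOf q [] (a :: R)) = some (cfgOf q' [] (default :: a :: R)) := by
  simp [TM0.step, cfgOf, h]

theorem rot_of {α : Type} (u v : List α) {x y : List α} (hx : x = u ++ v) (hy : y = v ++ u) :
    x ~r y := by
  subst hx hy; exact List.isRotated_append

theorem rot_app {α : Type} (u v : List α) : (u ++ v) ~r (v ++ u) := List.isRotated_append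

theorem tape_split {a : Γ} {w : List (TSym Γ Λ)} {L R : List Γ}
    (h : tape a :: w = R.map tape ++ hash :: (L.map tape).reverse) :
    ∃ R', R = a :: R' ∧ w = R'.map tape ++ hash :: (L.map tape).reverse := by
  cases R with
  | nil => simp at h
  | cons b R => simp at h; obtain ⟨rfl, rfl⟩ := h; simp

theorem pacc_sound {M : TM0.Machine Γ Λ} {w : List (TSym Γ Λ)} (h : PAcc (PRules M) halt w) :
    ∀ q L R, w ~r encW q L R → Halts M (cfgOf q L R) := by
  induction h with
  | halt w =>
    intro q L R h
    have := h.perm.subset (List.mem_cons_self)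
    simp [encW] at this
  | rule u v w hr _ ih =>
    intro q L R h
    cases hr with
    | copy s => exact ih q L R ((rot_app w [s]).trans h)
    | ext q =>
      obtain ⟨rfl, e⟩ := rot_enc h
      cases R with
      | cons b R => simp at e
      | nil =>
        simp at e
        subst e
        rw [← cfgOf_blank]
        exact ih q L [default] (rot_of (L.map tape).reverse [st q, tape default, hash]
          (by simp) (by simp [encW]))
    | fini q a hm =>
      obtain ⟨rfl, e⟩ := rot_enc h
      obtain ⟨R', rfl, e'⟩ := tape_split e
      clear e
      change w = _ at e'
      exact halts_none (step_stop hm _ _)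
    | write q a q' b hm =>
      obtain ⟨rfl, e⟩ := rot_enc h
      obtain ⟨R', rfl, e'⟩ := tape_split e
      clear e
      change w = _ at e'
      rw [halts_step (step_write hm _ _)]
      subst e'
      exact ih _ _ _ (rot_of (R'.map tape ++ hash :: (L.map tape).reverse) [st q', tape b]
        (by simp) (by simp [encW]))
    | right q a q' hm =>
      obtain ⟨rfl, e⟩ := rot_enc h
      obtain ⟨R', rfl, e'⟩ := tape_split e
      clear e
      change w = _ at e'
      rw [halts_step (step_right hm _ _)]
      subst e'
      refine ih _ _ _ ?_
      exact rot_of (R'.map tape ++ hash :: (L.map tape).reverse ++ [tape a]) [st q']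
        (by simp) (by simp [encW])
    | left q a q' c hm =>
      obtain ⟨rfl, e⟩ := rot_enc ((rot_app [tape c] ([st q, tape a] ++ w)).symm.trans h)
      obtain ⟨R', rfl, e'⟩ := tape_split e
      clear e
      change w ++ [tape c] = _ at e'
      cases L with
      | nil =>
        have := congrArg List.getLast? e'
        simp at this
      | cons d L =>
        rw [List.map_cons, List.reverse_cons, ← List.cons_append, ← List.append_assoc] at e'
        obtain ⟨e1, e2⟩ := List.append_inj' e' rfl
        simp at e2
        subst e1 e2
        rw [halts_step (step_left hm _ _ _)]
        refine ih _ _ _ ?_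
        exact rot_of (R'.map tape ++ hash :: (L.map tape).reverse) [st q', tape c, tape a]
              (by simp [encW]) (by simp [encW])
    | left' q a q' hm =>
      obtain ⟨rfl, e⟩ := rot_enc ((rot_app [hash] ([st q, tape a] ++ w)).symm.trans h)
      obtain ⟨R', rfl, e'⟩ := tape_split e
      clear e
      change w ++ [hash] = _ at e'
      cases L with
      | cons d L =>
        rw [List.map_cons, List.reverse_cons, ← List.cons_append, ← List.append_assoc] at e'
        obtain ⟨e1, e2⟩ := List.append_inj' e' rfl
        simp at e2
      | nil =>
        obtain ⟨e1, e2⟩ := List.append_inj' e' rfl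
        subst e1
        rw [halts_step (step_left' hm _)]
        refine ih _ _ _ ?_
        exact rot_of (R'.map tape ++ [hash]) [st q', tape default, tape a]
              (by simp [encW]) (by simp [encW])

theorem pacc_rot {M : TM0.Machine Γ Λ} {w w' : List (TSym Γ Λ)} (h : w ~r w')
    (h' : PAcc (PRules M) halt w') : PAcc (PRules M) halt w := by
  obtain ⟨n, rfl⟩ := h
  induction n generalizing w with
  | zero => simpa using h'
  | succ n ih =>
    cases w with
    | nil => simpa using h'
    | cons a t =>
      rw [List.rotate_cons_succ] at h'
      exact PAcc.rule [a] [a] t (PRule.copy a) (ih h')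

theorem pacc_complete_aux {M : TM0.Machine Γ Λ} (q : Λ) (L R : List Γ) (a : Γ)
    (ih : ∀ c', TM0.step M (cfgOf q L (a :: R)) = some c' →
      ∀ q L R, c' = cfgOf q L R → PAcc (PRules M) halt (encW q L R)) :
    PAcc (PRules M) halt (encW q L (a :: R)) := by
  rcases hm : M q a with _ | ⟨q', s⟩
  · refine PAcc.rule [st q, tape a] [halt] _ (PRule.fini _ _ hm) ?_
    exact pacc_rot (rot_app _ _) (PAcc.halt _)
  · rcases s with d | b
    · cases d with
      | left =>
        cases L with
        | nil =>
          have := ih _ (step_left' hm _) _ _ _ rfl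
          refine pacc_rot (w' := [hash, st q, tape a] ++ R.map tape) ?_
            (PAcc.rule _ _ _ (PRule.left' _ _ _ hm) (pacc_rot ?_ this))
          · exact rot_of ([st q, tape a] ++ R.map tape) [hash]
              (by simp [encW]) (by simp [encW])
          · exact rot_of (R.map tape ++ [hash]) [st q', tape default, tape a]
              (by simp [encW]) (by simp [encW])
        | cons c L =>
          have := ih _ (step_left hm _ _ _) _ _ _ rfl
          refine pacc_rot (w' := [tape c, st q, tape a] ++
            (R.map tape ++ hash :: (L.map tape).reverse)) ?_
            (PAcc.rule _ _ _ (PRule.left _ _ _ _ hm) (pacc_rot ?_ this))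
          · exact rot_of ([st q, tape a] ++ R.map tape ++ hash :: (L.map tape).reverse) [tape c]
              (by simp [encW]) (by simp [encW])
          · exact rot_of (R.map tape ++ hash :: (L.map tape).reverse) [st q', tape c, tape a]
              (by simp [encW]) (by simp [encW])
      | right =>
        have := ih _ (step_right hm _ _) _ _ _ rfl
        refine PAcc.rule [st q, tape a] _ _ (PRule.right _ _ _ hm) (pacc_rot ?_ this)
        exact rot_of (R.map tape ++ hash :: (L.map tape).reverse ++ [tape a]) [st q']
              (by simp [encW]) (by simp [encW])
    · have := ih _ (step_write hm _ _) _ _ _ rfl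
      refine PAcc.rule [st q, tape a] _ _ (PRule.write _ _ _ _ hm) (pacc_rot ?_ this)
      exact rot_of (R.map tape ++ hash :: (L.map tape).reverse) [st q', tape b]
              (by simp [encW]) (by simp [encW])

theorem pacc_complete {M : TM0.Machine Γ Λ} {c : TM0.Cfg Γ Λ} (h : Halts M c) :
    ∀ q L R, c = cfgOf q L R → PAcc (PRules M) halt (encW q L R) := by
  obtain ⟨d, hd⟩ := Part.dom_iff_mem.1 h
  refine StateTransition.evalInduction (C := fun c => ∀ q L R, c = cfgOf q L R →
    PAcc (PRules M) halt (encW q L R)) hd ?_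
  intro c _ ih q L R hc
  subst hc
  cases R with
  | cons a R => exact pacc_complete_aux q L R a ih
  | nil =>
    rw [← cfgOf_blank] at ih
    have := pacc_complete_aux q L [] default ih
    refine PAcc.rule [st q, hash] _ _ (PRule.ext q) (pacc_rot ?_ this)
    exact rot_of ((L.map tape).reverse) [st q, tape default, hash]
              (by simp [encW]) (by simp [encW])

theorem pacc_iff (M : TM0.Machine Γ Λ) (l : List Γ) :
    PAcc (PRules M) halt (encW default [] l) ↔ (TM0.eval M l).Dom :=
  ⟨fun h => pacc_sound h _ _ _ (List.IsRotated.refl _), fun h => pacc_complete h _ _ _ rfl⟩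

end PNS

/-! ### One-participant networks as queue automata -/

abbrev NRow : Type := ℕ × ℕ × (Bool × ℕ × ℕ × ℕ) × ℕ

/-- Accepting runs of a one-participant network, from a state and a queue of payloads. -/
inductive QRun (T : List NRow) (F : List (ℕ × ℕ)) : ℕ → List ℕ → Prop
  | done (s : ℕ) (q : List ℕ) : (0, s) ∈ F → QRun T F s q
  | send (s p t : ℕ) (q : List ℕ) : (0, s, (true, 0, 0, p), t) ∈ T → QRun T F t (q ++ [p]) →
      QRun T F s q
  | recv (s p t : ℕ) (q : List ℕ) : (0, s, (false, 0, 0, p), t) ∈ T → QRun T F t q →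
      QRun T F s (p :: q)

abbrev net1 (T : List NRow) (F : List (ℕ × ℕ)) : Network (Fin 1) ℕ := decodeNet (1, T, F, [])

theorem qrun_of_steps {T : List NRow} {F : List (ℕ × ℕ)} {c c' : MbConfig (net1 T F)}
    {w : List (Act (Fin 1) ℕ)} (h : Steps (MbStep (net1 T F)) c w c') (hf : MbFinal _ c') :
    QRun T F (c.st 0) ((c.buf 0).map Msg.payload) := by
  induction h with
  | nil c => exact QRun.done _ _ (hf 0)
  | cons hs _ ih =>
    have ih := ih hf
    cases hs with
    | send m s' ht =>
      obtain ⟨a, b, p⟩ := m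
      obtain rfl : a = 0 := Subsingleton.elim _ _
      obtain rfl : b = 0 := Subsingleton.elim _ _
      refine QRun.send _ p s' _ ht ?_
      simpa using ih
    | recv m s' rest ht hb =>
      obtain ⟨a, b, p⟩ := m
      obtain rfl : a = 0 := Subsingleton.elim _ _
      obtain rfl : b = 0 := Subsingleton.elim _ _
      simp only at hb
      rw [hb]
      refine QRun.recv _ p s' _ ht ?_
      simpa using ih

theorem steps_of_qrun {T : List NRow} {F : List (ℕ × ℕ)} {s : ℕ} {q : List ℕ} (h : QRun T F s q) :
    ∀ c : MbConfig (net1 T F), c.st 0 = s → c.buf 0 = q.map (fun p => ⟨0, 0, p⟩) →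
      ∃ w c', Steps (MbStep (net1 T F)) c w c' ∧ MbFinal _ c' := by
  induction h with
  | done s q hF =>
    intro c hs hq
    refine ⟨[], c, Steps.nil c, ?_⟩
    intro p
    obtain rfl : p = 0 := Subsingleton.elim _ _
    rw [hs]
    exact hF
  | send s p t q ht _ ih =>
    intro c hs hq
    subst hs
    have st := MbStep.send (N := net1 T F) c ⟨0, 0, p⟩ t ht
    obtain ⟨w, c', h1, h2⟩ := ih ⟨Function.update c.st 0 t, Function.update c.buf 0 (c.buf 0 ++ [⟨0, 0, p⟩])⟩
      (Function.update_self (β := (net1 T F).State) 0 t c.st) (by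
        change Function.update c.buf 0 (c.buf 0 ++ [⟨0, 0, p⟩]) 0 = _
        rw [Function.update_self, hq, List.map_append]
        rfl)
    exact ⟨_, c', Steps.cons st h1, h2⟩
  | recv s p t q ht _ ih =>
    intro c hs hq
    subst hs
    have st := MbStep.recv (N := net1 T F) c ⟨0, 0, p⟩ t (q.map (fun p => ⟨0, 0, p⟩)) ht
      (by simpa using hq)
    obtain ⟨w, c', h1, h2⟩ := ih ⟨Function.update c.st 0 t,
      Function.update c.buf 0 (q.map (fun p => ⟨0, 0, p⟩))⟩
      (Function.update_self (β := (net1 T F).State) 0 t c.st) (by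
        change Function.update c.buf 0 (q.map (fun p => ⟨0, 0, p⟩)) 0 = _
        rw [Function.update_self])
    exact ⟨_, c', Steps.cons st h1, h2⟩

theorem mbTraces_empty_iff (T : List NRow) (F : List (ℕ × ℕ)) :
    MbTraces (net1 T F) = ∅ ↔ ¬ QRun T F 0 [] := by
  rw [MbTraces, Set.image_eq_empty, Set.eq_empty_iff_forall_notMem, ← not_exists, not_iff_not]
  constructor
  · rintro ⟨w, c, h, hf⟩
    exact qrun_of_steps h hf
  · intro h
    obtain ⟨w, c', h1, h2⟩ := steps_of_qrun h (MbInit (net1 T F)) rfl rfl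
    exact ⟨w, c', h1, h2⟩

theorem syncTraces_empty (T : List NRow) (F : List (ℕ × ℕ)) (hF : (0, 0) ∉ F)
    (hT : ∀ p t, (0, 0, (false, 0, 0, p), t) ∉ T) : SyncTraces (net1 T F) = ∅ := by
  rw [SyncTraces, Set.image_eq_empty, Set.eq_empty_iff_forall_notMem]
  rintro w ⟨c, h, hf⟩
  cases h with
  | nil => exact hF (hf 0)
  | cons hs _ =>
    cases hs with
    | comm m s1 s2 h1 h2 =>
      obtain ⟨a, b, p⟩ := m
      obtain rfl : a = 0 := Subsingleton.elim _ _
      obtain rfl : b = 0 := Subsingleton.elim _ _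
      exact hT p s2 h2

/-! ### The queue automaton of a Post normal system -/

/-- Transitions. A state `some (x, y)` still has to pop `x` and then push `y`;
`none` is the accepting state. -/
inductive QT {α : Type} (R : Set (List α × List α)) (h : α) :
    Option (List α × List α) → Bool → α → Option (List α × List α) → Prop
  | pop (a : α) (x y : List α) : (a :: x).length ≤ 4 → y.length ≤ 4 →
      QT R h (some (a :: x, y)) false a (some (x, y))
  | push (b : α) (y : List α) : (b :: y).length ≤ 4 →
      QT R h (some ([], b :: y)) true b (some ([], y))
  | start (a : α) (x y : List α) : (a :: x, y) ∈ R → (a :: x).length ≤ 4 → y.length ≤ 4 →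
      QT R h (some ([], [])) false a (some (x, y))
  | fin : QT R h (some ([], [])) false h none

def stCode {α : Type} [Encodable α] (s : Option (List α × List α)) : ℕ := 2 * Encodable.encode s + 1

theorem stCode_inj {α : Type} [Encodable α] {s t : Option (List α × List α)}
    (h : stCode s = stCode t) : s = t := by
  apply Encodable.encode_injective
  unfold stCode at h
  omega

theorem exists_fixed {α : Type} [Finite α] [Encodable α] (R : Set (List α × List α)) (h : α) :
    ∃ T : List NRow, ∀ r, r ∈ T ↔ ∃ s b a t, QT R h s b a t ∧
      r = (0, stCode s, (b, 0, 0, Encodable.encode a), stCode t) := by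
  let S : Set (Option (List α × List α)) :=
    insert none (some '' ({l : List α | l.length ≤ 4} ×ˢ {l : List α | l.length ≤ 4}))
  have hS : S.Finite := (((List.finite_length_le α 4).prod (List.finite_length_le α 4)).image
    some).insert none
  have hfin : {x : Option (List α × List α) × (Bool × α) × Option (List α × List α) |
      QT R h x.1 x.2.1.1 x.2.1.2 x.2.2}.Finite := by
    refine Set.Finite.subset (hS.prod ((Set.finite_univ (α := Bool × α)).prod hS)) ?_
    rintro ⟨s, ⟨b, a⟩, t⟩ hx
    simp only [Set.mem_setOf_eq] at hx
    cases hx <;> simp_all [S] <;> omega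
  have himg := hfin.image (fun x => ((0, stCode x.1, (x.2.1.1, 0, 0, Encodable.encode x.2.1.2),
    stCode x.2.2) : NRow))
  refine ⟨himg.toFinset.toList, fun r => ?_⟩
  simp only [Finset.mem_toList, Set.Finite.mem_toFinset, Set.mem_image, Set.mem_setOf_eq]
  constructor
  · rintro ⟨⟨s, ⟨b, a⟩, t⟩, h1, rfl⟩
    exact ⟨s, b, a, t, h1, rfl⟩
  · rintro ⟨s, b, a, t, h1, rfl⟩
    exact ⟨⟨s, ⟨b, a⟩, t⟩, h1, rfl⟩

/-- Rows writing the initial queue `p ++ [e]`, ending in state `hub`. -/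
def chainRows (p : List ℕ) (e hub : ℕ) : List NRow :=
  (0, 2 * p.length, (true, 0, 0, e), hub) ::
    (List.range p.length).map (fun i => (0, 2 * i, (true, 0, 0, p.getD i 0), 2 * i + 2))

section
variable {α : Type} [Encodable α] {R : Set (List α × List α)} {h : α}
  {T0 : List NRow} {p : List ℕ} {e : ℕ}

local notation "FF" => [((0 : ℕ), stCode (none : Option (List α × List α)))]
local notation "hubC" => stCode (some (([] : List α), ([] : List α)))

theorem row_odd
    (hT0 : ∀ r, r ∈ T0 ↔ ∃ s b a t, QT R h s b a t ∧
      r = (0, stCode s, (b, 0, 0, Encodable.encode a), stCode t))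
    {s : Option (List α × List α)} {b : Bool} {a t : ℕ}
    (hr : (0, stCode s, (b, 0, 0, a), t) ∈ chainRows p e hubC ++ T0) :
    ∃ a' t', a = Encodable.encode a' ∧ t = stCode t' ∧ QT R h s b a' t' := by
  rcases List.mem_append.1 hr with hr | hr
  · simp [chainRows, stCode] at hr
    omega
  · obtain ⟨s', b', a', t', hq, e⟩ := (hT0 _).1 hr
    simp only [Prod.mk.injEq] at e
    obtain ⟨-, e1, ⟨rfl, -, -, rfl⟩, rfl⟩ := e
    obtain rfl := stCode_inj e1
    exact ⟨a', t', rfl, rfl, hq⟩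

theorem row_even
    (hT0 : ∀ r, r ∈ T0 ↔ ∃ s b a t, QT R h s b a t ∧
      r = (0, stCode s, (b, 0, 0, Encodable.encode a), stCode t))
    {i : ℕ} {b : Bool} {a t : ℕ}
    (hr : (0, 2 * i, (b, 0, 0, a), t) ∈ chainRows p e hubC ++ T0) :
    b = true ∧ ((i = p.length ∧ a = e ∧ t = hubC) ∨
      (i < p.length ∧ a = p.getD i 0 ∧ t = 2 * (i + 1))) := by
  rcases List.mem_append.1 hr with hr | hr
  · simp only [chainRows, List.mem_cons, Prod.mk.injEq, List.mem_map, List.mem_range] at hr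
    rcases hr with ⟨-, h1, ⟨rfl, -, -, rfl⟩, rfl⟩ | ⟨j, hj, -, h1, ⟨rfl, -, -, rfl⟩, rfl⟩
    · exact ⟨rfl, .inl ⟨by omega, rfl, rfl⟩⟩
    · obtain rfl : j = i := by omega
      exact ⟨rfl, .inr ⟨hj, rfl, by ring⟩⟩
  · obtain ⟨s', b', a', t', hq, e⟩ := (hT0 _).1 hr
    simp only [Prod.mk.injEq, stCode] at e
    omega

theorem qrun_sound
    (hT0 : ∀ r, r ∈ T0 ↔ ∃ s b a t, QT R h s b a t ∧
      r = (0, stCode s, (b, 0, 0, Encodable.encode a), stCode t))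
    {s : ℕ} {q : List ℕ} (hr : QRun (chainRows p e hubC ++ T0) FF s q) :
    ∀ (x y z : List α), s = stCode (some (x, y)) → q = z.map Encodable.encode →
      ∃ w, z = x ++ w ∧ PAcc R h (w ++ y) := by
  induction hr with
  | done s q hF =>
    intro x y z hs hq
    simp only [List.mem_singleton, Prod.mk.injEq, true_and] at hF
    rw [hs] at hF
    have := stCode_inj hF
    simp at this
  | send s a t q hrow _ ih =>
    intro x y z hs hq
    subst hs hq
    obtain ⟨a', t', rfl, rfl, hqt⟩ := row_odd hT0 hrow
    cases hqt with
    | push _ y' hl =>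
      obtain ⟨w, e1, e2⟩ := ih [] y' (z ++ [a']) rfl (by simp)
      refine ⟨z, rfl, ?_⟩
      simp only [List.nil_append] at e1
      subst e1
      simpa using e2
  | recv s a t q hrow _ ih =>
    intro x y z hs hq
    subst hs
    obtain ⟨a', t', rfl, rfl, hqt⟩ := row_odd hT0 hrow
    cases z with
    | nil => simp at hq
    | cons c z =>
      simp only [List.map_cons, List.cons.injEq] at hq
      obtain ⟨hc, rfl⟩ := hq
      obtain rfl := Encodable.encode_injective hc
      cases hqt with
      | pop _ x' _ _ _ =>
        obtain ⟨w, rfl, e2⟩ := ih x' y z rfl rfl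
        exact ⟨w, rfl, e2⟩
      | start _ x' y' hR _ _ =>
        obtain ⟨w, rfl, e2⟩ := ih x' y' z rfl rfl
        refine ⟨_, rfl, ?_⟩
        simpa using PAcc.rule _ _ w hR e2
      | fin => exact ⟨_, rfl, PAcc.halt _⟩

theorem qrun_push
    (hT0 : ∀ r, r ∈ T0 ↔ ∃ s b a t, QT R h s b a t ∧
      r = (0, stCode s, (b, 0, 0, Encodable.encode a), stCode t))
    (y : List α) (hy : y.length ≤ 4) (z : List α)
    (hr : QRun (chainRows p e hubC ++ T0) FF hubC ((z ++ y).map Encodable.encode)) :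
    QRun (chainRows p e hubC ++ T0) FF (stCode (some (([] : List α), y)))
      (z.map Encodable.encode) := by
  induction y generalizing z with
  | nil => simpa using hr
  | cons b y ih =>
    refine QRun.send _ (Encodable.encode b) (stCode (some (([] : List α), y))) _
      (List.mem_append_right _ ((hT0 _).2 ⟨_, _, _, _, QT.push b y hy, rfl⟩)) ?_
    have := ih (by simp at hy; omega) (z ++ [b]) (by simpa using hr)
    simpa using this

theorem qrun_pop
    (hT0 : ∀ r, r ∈ T0 ↔ ∃ s b a t, QT R h s b a t ∧
      r = (0, stCode s, (b, 0, 0, Encodable.encode a), stCode t))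
    (x y : List α) (hx : x.length ≤ 4) (hy : y.length ≤ 4) (z : List α)
    (hr : QRun (chainRows p e hubC ++ T0) FF hubC ((z ++ y).map Encodable.encode)) :
    QRun (chainRows p e hubC ++ T0) FF (stCode (some (x, y)))
      ((x ++ z).map Encodable.encode) := by
  induction x with
  | nil => exact qrun_push hT0 y hy z hr
  | cons a x ih =>
    exact QRun.recv _ (Encodable.encode a) (stCode (some (x, y))) _
      (List.mem_append_right _ ((hT0 _).2 ⟨_, _, _, _, QT.pop a x y hx hy, rfl⟩))
      (ih (by simp at hx; omega))

theorem qrun_complete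
    (hT0 : ∀ r, r ∈ T0 ↔ ∃ s b a t, QT R h s b a t ∧
      r = (0, stCode s, (b, 0, 0, Encodable.encode a), stCode t))
    (hR : ∀ u v, (u, v) ∈ R → u ≠ [] ∧ u.length ≤ 4 ∧ v.length ≤ 4)
    {w : List α} (hw : PAcc R h w) :
    QRun (chainRows p e hubC ++ T0) FF hubC (w.map Encodable.encode) := by
  induction hw with
  | halt w =>
    exact QRun.recv _ (Encodable.encode h) (stCode (none : Option (List α × List α))) _
      (List.mem_append_right _ ((hT0 _).2 ⟨_, _, _, _, QT.fin, rfl⟩))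
      (QRun.done _ _ (by simp))
  | rule u v w hr _ ih =>
    obtain ⟨h1, h2, h3⟩ := hR u v hr
    cases u with
    | nil => exact absurd rfl h1
    | cons a x =>
      exact QRun.recv _ (Encodable.encode a) (stCode (some (x, v))) _
        (List.mem_append_right _ ((hT0 _).2 ⟨_, _, _, _, QT.start a x v hr h2 h3, rfl⟩))
        (qrun_pop hT0 x v (by simp at h2; omega) h3 w ih)

theorem qrun_chain_sound
    (hT0 : ∀ r, r ∈ T0 ↔ ∃ s b a t, QT R h s b a t ∧
      r = (0, stCode s, (b, 0, 0, Encodable.encode a), stCode t))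
    {s : ℕ} {q : List ℕ} (hr : QRun (chainRows p e hubC ++ T0) FF s q) :
    ∀ i, s = 2 * i → q = p.take i →
      QRun (chainRows p e hubC ++ T0) FF hubC (p ++ [e]) := by
  induction hr with
  | done s q hF =>
    intro i hs hq
    simp only [List.mem_singleton, Prod.mk.injEq, true_and, stCode] at hF
    omega
  | send s a t q hrow hrun ih =>
    intro i hs hq
    subst hs hq
    obtain ⟨-, ⟨rfl, rfl, rfl⟩ | ⟨hi, rfl, rfl⟩⟩ := row_even hT0 hrow
    · simpa using hrun
    · refine ih (i + 1) rfl ?_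
      rw [List.take_succ]
      simp [hi]
  | recv s a t q hrow _ ih =>
    intro i hs hq
    subst hs
    simpa using (row_even hT0 hrow).1

theorem qrun_chain_complete
    (hr : QRun (chainRows p e hubC ++ T0) FF hubC (p ++ [e])) (k : ℕ) (hk : k ≤ p.length) :
    QRun (chainRows p e hubC ++ T0) FF (2 * (p.length - k)) (p.take (p.length - k)) := by
  induction k with
  | zero =>
    refine QRun.send _ e hubC _ (List.mem_append_left _ (by simp [chainRows])) ?_
    simpa using hr
  | succ k ih =>
    have hi : p.length - (k + 1) < p.length := by omega
    have hs : p.length - k = p.length - (k + 1) + 1 := by omega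
    rw [hs] at ih
    generalize p.length - (k + 1) = i at *
    refine QRun.send _ (p.getD i 0) (2 * i + 2) _ (List.mem_append_left _ ?_) ?_
    · simp only [chainRows, List.mem_cons, List.mem_map, List.mem_range]
      exact .inr ⟨i, hi, rfl⟩
    · have := ih (by omega)
      change QRun _ _ (2 * (i + 1)) _
      have hg : p.take i ++ [p.getD i 0] = p.take (i + 1) := by simp [hi]
      rw [hg]
      exact this

/-- The network accepts something in the mailbox semantics iff the normal system accepts. -/
theorem sync_iff
    (hT0 : ∀ r, r ∈ T0 ↔ ∃ s b a t, QT R h s b a t ∧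
      r = (0, stCode s, (b, 0, 0, Encodable.encode a), stCode t))
    (hR : ∀ u v, (u, v) ∈ R → u ≠ [] ∧ u.length ≤ 4 ∧ v.length ≤ 4)
    (w : List α) (hw : p ++ [e] = w.map Encodable.encode) :
    MbTraces (decodeNet (1, chainRows p e hubC ++ T0, FF, [])) =
      SyncTraces (decodeNet (1, chainRows p e hubC ++ T0, FF, [])) ↔ ¬ PAcc R h w := by
  have hs : SyncTraces (net1 (chainRows p e hubC ++ T0) FF) = ∅ := by
    refine syncTraces_empty _ _ (by simp [stCode]) ?_
    intro a t hr
    have := row_even (i := 0) hT0 hr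
    simp at this
  change MbTraces (net1 _ _) = SyncTraces (net1 _ _) ↔ _
  rw [hs, mbTraces_empty_iff, not_iff_not]
  constructor
  · intro hr
    have h1 := qrun_chain_sound hT0 hr 0 rfl (by simp)
    rw [hw] at h1
    obtain ⟨w', rfl, h2⟩ := qrun_sound hT0 h1 [] [] w rfl rfl
    simpa using h2
  · intro ha
    have h1 := qrun_complete (p := p) (e := e) hT0 hR ha
    rw [← hw] at h1
    have := qrun_chain_complete h1 p.length le_rfl
    simpa using this

end

theorem chainRows_primrec (e hub : ℕ) : Primrec (fun p : List ℕ => chainRows p e hub) := by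
  unfold chainRows
  have h2 : Primrec (fun n : ℕ => 2 * n) := Primrec.nat_mul.comp (Primrec.const 2) Primrec.id
  refine Primrec.list_cons.comp ?_ (Primrec.list_map (Primrec.list_range.comp Primrec.list_length) ?_)
  · exact (Primrec.const 0).pair ((h2.comp Primrec.list_length).pair (Primrec.const _))
  · refine (Primrec.const 0).pair ((h2.comp Primrec.snd).pair (Primrec.pair ?_ ?_))
    · refine (Primrec.const true).pair ((Primrec.const 0).pair ((Primrec.const 0).pair ?_))
      exact (Primrec.list_getD 0).comp Primrec.fst Primrec.snd
    · exact Primrec.nat_add.comp (h2.comp Primrec.snd) (Primrec.const 2)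

/-- the Generalised Synchronisability Problem for mailbox systems is
undecidable: no computable function decides, for a given (coded) network of communicating
automata with final states, whether the mailbox trace set equals the synchronous trace set. -/
theorem generalised_synchronisability_undecidable :
    ¬ ∃ f : NetCode → Bool, Computable f ∧
      ∀ c : NetCode,
        (f c = true ↔ MbTraces (decodeNet c) = SyncTraces (decodeNet c)) := by
  rintro ⟨f, hf, hfs⟩
  obtain ⟨Γ, Λ, i1, i2, i3, i4, M, x, y, z, hM⟩ := exists_source
  obtain ⟨enc⟩ := nonempty_encodable (TSym Γ Λ)
  obtain ⟨T0, hT0⟩ := exists_fixed (PRules M) TSym.halt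
  let e : ℕ := Encodable.encode (TSym.hash : TSym Γ Λ)
  let hub : ℕ := stCode (some (([] : List (TSym Γ Λ)), ([] : List (TSym Γ Λ))))
  let cx : ℕ := Encodable.encode (TSym.tape x : TSym Γ Λ)
  let cy : ℕ := Encodable.encode (TSym.tape y : TSym Γ Λ)
  let cz : ℕ := Encodable.encode (TSym.tape z : TSym Γ Λ)
  let cq : ℕ := Encodable.encode (TSym.st default : TSym Γ Λ)
  let p : ℕ → List ℕ := fun n => cq :: cx :: (natBits n).reverse.map (fun b => cond b cy cz)
  have hp : Primrec p := by
    refine Primrec.list_cons.comp (Primrec.const cq) (Primrec.list_cons.comp (Primrec.const cx)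
      (Primrec.list_map (Primrec.list_reverse.comp natBits_primrec) ?_))
    exact Primrec.cond Primrec.snd (Primrec.const cy) (Primrec.const cz)
  let code : ℕ → NetCode := fun n => (1, chainRows (p n) e hub ++ T0,
    [(0, stCode (none : Option (List (TSym Γ Λ) × List (TSym Γ Λ))))], [])
  have hcode : Primrec code := by
    refine (Primrec.const 1).pair (Primrec.pair ?_ (Primrec.const _))
    exact Primrec.list_append.comp ((chainRows_primrec e hub).comp hp) (Primrec.const T0)
  have key : ∀ n, f (code n) = true ↔
      ¬ (Nat.Partrec.Code.eval (Denumerable.ofNat Nat.Partrec.Code n) 0).Dom := by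
    intro n
    rw [hfs, ← hM, ← pacc_iff]
    refine sync_iff hT0 ?_ _ ?_
    · intro u v huv
      refine ⟨PRules_ne_nil huv, ?_⟩
      cases huv <;> simp
    · simp only [p, encW, e]
      simp [cq, cx]
      exact ⟨fun _ => rfl, fun _ => rfl⟩
  refine ComputablePred.halting_problem 0 ?_
  have hg : Computable (fun c : Nat.Partrec.Code => !(f (code (Encodable.encode c)))) :=
    Primrec.not.to_comp.comp (hf.comp (hcode.to_comp.comp Computable.encode))
  refine ComputablePred.computable_iff.2 ⟨_, hg, ?_⟩
  funext c
  have := key (Encodable.encode c)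
  rw [Denumerable.ofNat_encode] at this
  apply propext
  change _ ↔ (!(f (code (Encodable.encode c)))) = true
  rw [Bool.not_eq_true', ← Bool.not_eq_true, this, not_not]
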